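/- Fix j ∈ {1,…,n} and suppose that for every true null index i ∈ T the p-value distribution function satisfies F_i(λ_{ij}) = P(p_i ≤ λ_{ij}) = λ_{ij}. Then E[β(τ_j)] = (m_0/m)·(1-τ_j)/(1-η_j) + 1/(m(1-η_j)) + ((1-τ_j)/(m(1-η_j))) Σ_{i∈F} (1 - G_i(λ_{ij}))/(1-λ_{ij}), where G_i(t) = P(p_i ≤ t) for i ∈ F. In particular, since η_j ≥ τ_j, the bias E[β(τ_j)] - m_0/m is greater than or equal to 1/(m(1-η_j)), hence nonnegative. -/

import Mathlib

open Finset MeasureTheory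

/-- The mean of the indicator of an upper tail is one minus the distribution function. -/
theorem integral_ite_lt_eq_one_sub {Ω : Type*} [MeasurableSpace Ω] (μ : Measure Ω)
    [IsProbabilityMeasure μ] {X : Ω → ℝ} (hX : Measurable X) (a : ℝ) :
    Integrable (fun ω => if a < X ω then (1 : ℝ) else 0) μ ∧
      ∫ ω, (if a < X ω then (1 : ℝ) else 0) ∂μ = 1 - (μ {ω | X ω ≤ a}).toReal := by
  have hle : MeasurableSet {ω | X ω ≤ a} := measurableSet_le hX measurable_const
  have hind : (fun ω => if a < X ω then (1 : ℝ) else 0)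
      = {ω | X ω ≤ a}ᶜ.indicator fun _ => (1 : ℝ) := by
    ext ω
    simp [Set.indicator_apply]
  rw [hind]
  refine ⟨(integrable_const 1).indicator hle.compl, ?_⟩
  rw [integral_indicator_const _ hle.compl, probReal_compl_eq_one_sub hle]
  simp [Measure.real]

/-- Fix `j` and suppose `F_i(λ_{ij}) = P(p_i ≤ λ_{ij}) = λ_{ij}` for every true null
`i ∈ T`.  Then `E[β(τ_j)] = (m₀/m)(1-τ_j)/(1-η_j) + 1/(m(1-η_j))
+ ((1-τ_j)/(m(1-η_j))) ∑_{i∈F} (1-G_i(λ_{ij}))/(1-λ_{ij})`; in particular, since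
`η_j ≥ τ_j`, the bias `E[β(τ_j)] - m₀/m` is at least `1/(m(1-η_j))`, hence nonnegative. -/
theorem expectation_beta_eq_of_null_uniform_and_bias_nonneg
    {Ω : Type*} [MeasureSpace Ω] [IsProbabilityMeasure (volume : Measure Ω)]
    (m n : ℕ) (hm : 0 < m) (hn : 0 < n)
    (T : Finset (Fin m)) (m₀ : ℕ) (hm₀ : m₀ = T.card)
    (p : Fin m → Ω → ℝ) (hmeas : ∀ i, Measurable (p i))
    (hval : ∀ i ω, p i ω ∈ Set.Icc (0 : ℝ) 1)
    (τ : Fin n → ℝ) (hτmono : Monotone τ)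
    (hτ : ∀ j, τ j ∈ Set.Ioo (0 : ℝ) 1)
    (lam : Fin m → Fin n → ℝ)
    (hlam : ∀ i j, lam i j ∈ Set.Ico (τ j) 1)
    (η : Fin n → ℝ)
    (hη : ∀ j, IsGreatest (Set.range fun i => lam i j) (η j))
    (β : Fin n → Ω → ℝ)
    (hβ : ∀ j ω, β j ω = 1 / (m * (1 - η j)) + (1 - τ j) / (m * (1 - η j)) *
        ∑ i, (if lam i j < p i ω then (1 : ℝ) else 0) / (1 - lam i j))
    (j : Fin n)
    (hF : ∀ i ∈ T, (volume {ω | p i ω ≤ lam i j}).toReal = lam i j) :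
    (∫ ω, β j ω = (m₀ / m : ℝ) * ((1 - τ j) / (1 - η j)) + 1 / (m * (1 - η j)) +
        (1 - τ j) / (m * (1 - η j)) *
          ∑ i ∈ Tᶜ, (1 - (volume {ω | p i ω ≤ lam i j}).toReal) / (1 - lam i j))
    ∧ 1 / (m * (1 - η j)) ≤ (∫ ω, β j ω) - m₀ / m
    ∧ 0 ≤ (∫ ω, β j ω) - m₀ / m := by
  have hm' : (0 : ℝ) < m := by exact_mod_cast hm
  have hlam1 : ∀ i, 0 < 1 - lam i j := fun i => sub_pos.2 (hlam i j).2
  have hητ : τ j ≤ η j ∧ η j < 1 := by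
    obtain ⟨i, hi⟩ := (hη j).1
    exact hi ▸ hlam i j
  have hη1 : 0 < 1 - η j := by linarith
  have hτ1 : 0 < 1 - τ j := by linarith
  have hint i := integral_ite_lt_eq_one_sub (volume : Measure Ω) (hmeas i) (lam i j)
  have hsum : ∑ i, (1 - (volume {ω | p i ω ≤ lam i j}).toReal) / (1 - lam i j)
      = m₀ + ∑ i ∈ Tᶜ, (1 - (volume {ω | p i ω ≤ lam i j}).toReal) / (1 - lam i j) := by
    rw [← Finset.sum_add_sum_compl T, hm₀]
    congr 1
    rw [Finset.sum_congr rfl fun i hi => by rw [hF i hi, div_self (hlam1 i).ne']]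
    simp
  have hmean : ∫ ω, β j ω = (m₀ / m : ℝ) * ((1 - τ j) / (1 - η j)) + 1 / (m * (1 - η j)) +
      (1 - τ j) / (m * (1 - η j)) *
        ∑ i ∈ Tᶜ, (1 - (volume {ω | p i ω ≤ lam i j}).toReal) / (1 - lam i j) := by
    simp_rw [hβ j]
    rw [integral_add (integrable_const _)
        ((integrable_finsetSum _ fun i _ => (hint i).1.div_const _).const_mul _),
      integral_const_mul, integral_finsetSum _ fun i _ => (hint i).1.div_const _]
    simp_rw [integral_div, fun i => (hint i).2]
    rw [hsum]
    simp only [integral_const, probReal_univ, one_smul]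
    field_simp
    ring
  have hnonneg : 0 ≤ (1 - τ j) / (m * (1 - η j)) *
      ∑ i ∈ Tᶜ, (1 - (volume {ω | p i ω ≤ lam i j}).toReal) / (1 - lam i j) :=
    mul_nonneg (by positivity) <| Finset.sum_nonneg fun i _ =>
      div_nonneg (sub_nonneg.2 measureReal_le_one) (hlam1 i).le
  have hratio : (m₀ / m : ℝ) ≤ (m₀ / m : ℝ) * ((1 - τ j) / (1 - η j)) :=
    le_mul_of_one_le_right (by positivity) ((one_le_div hη1).2 (by linarith))
  have hbias : 1 / (m * (1 - η j)) ≤ (∫ ω, β j ω) - m₀ / m := by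
    rw [hmean]
    linarith
  exact ⟨hmean, hbias, le_trans (by positivity) hbias⟩
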